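/- arXiv:1802.07951 — 2 statements merged into one kernel-verified Lean document; each statement's English description precedes it below -/
import Mathlib

section
/- For any finite-dimensional Lie algebra L over a field of characteristic zero, i(L) ≤ α(L), where α(L) denotes the maximal dimension of an abelian Lie subalgebra of L. -/
open Module

/-- The stabilizer `L(ξ) = {x ∈ L | ξ ⁅x, y⁆ = 0 for all y}` of a linear functional. -/
def lieStab (k : Type*) [Field k] (L : Type*) [LieRing L] [LieAlgebra k L]
    (ξ : Module.Dual k L) : Submodule k L where
  carrier := {x | ∀ y, ξ ⁅x, y⁆ = 0}
  add_mem' := by intro a b ha hb y; rw [add_lie, map_add, ha y, hb y, add_zero]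
  zero_mem' := by intro y; rw [zero_lie, map_zero]
  smul_mem' := by intro c a ha y; rw [smul_lie, map_smul, ha y, smul_zero]

/-- The index `i(L)`: the minimal dimension of a stabilizer `L(ξ)`, `ξ ∈ L*`. -/
noncomputable def lieIndex (k : Type*) [Field k] (L : Type*) [LieRing L] [LieAlgebra k L] : ℕ :=
  sInf (Set.range fun ξ : Module.Dual k L => finrank k (lieStab k L ξ))

/-- The maximal abelian dimension `α(L)`. -/
noncomputable def maxAbelianDim (k : Type*) [Field k] (L : Type*) [LieRing L]
    [LieAlgebra k L] : ℕ :=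
  sSup {d : ℕ | ∃ H : LieSubalgebra k L, IsLieAbelian H ∧ finrank k H = d}

/-- The magic number `c(L) = (dim L + i(L))/2`. -/
noncomputable def magic (k : Type*) [Field k] (L : Type*) [LieRing L] [LieAlgebra k L] : ℕ :=
  (finrank k L + lieIndex k L) / 2

/-- If `g` does not map `ker f` into `range f`, then some member of the pencil `g - μ • f` has
larger rank than `f`. -/
theorem exists_finrank_range_lt_finrank_range_sub_smul {k V W : Type*} [Field k] [Infinite k]
    [AddCommGroup V] [Module k V] [AddCommGroup W] [Module k W] [Module.Finite k W]
    (f g : V →ₗ[k] W) {x : V} (hx : f x = 0) (hgx : g x ∉ LinearMap.range f) :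
    ∃ μ : k, finrank k (LinearMap.range f) < finrank k (LinearMap.range (g - μ • f)) := by
  obtain ⟨φ, hφ, hφf⟩ := Submodule.exists_le_ker_of_notMem hgx
  obtain ⟨s, hs⟩ := f.rangeRestrict.exists_rightInverse_of_surjective f.range_rangeRestrict
  obtain ⟨p, hp⟩ := (LinearMap.range f).subtype.exists_leftInverse_of_injective
    (Submodule.ker_subtype _)
  have hfs (w : LinearMap.range f) : f (s w) = w :=
    congrArg Subtype.val (LinearMap.congr_fun hs w)
  let T : End k W := g ∘ₗ s ∘ₗ p ∘ₗ (LinearMap.id - φ.smulRight ((φ (g x))⁻¹ • g x))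
  have hTx : T (g x) = 0 := by simp [T, smul_smul, hφ]
  have hTf (w : LinearMap.range f) : T w = g (s w) := by
    have h₁ : φ w = 0 := hφf w.2
    have h₂ : p w = w := LinearMap.congr_fun hp w
    simp [T, h₁, h₂]
  obtain ⟨μ, hμT⟩ := (Module.End.finite_hasEigenvalue T).exists_notMem
  have hinj : Function.Injective (T - μ • LinearMap.id : W →ₗ[k] W) := by
    rw [← LinearMap.ker_eq_bot]
    by_contra h
    obtain ⟨v, hv, hv₀⟩ := Submodule.exists_mem_ne_zero_of_ne_bot h
    refine hμT (Module.End.hasEigenvalue_of_hasEigenvector (x := v) ⟨?_, hv₀⟩)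
    rw [Module.End.mem_eigenspace_iff]
    simpa [sub_eq_zero] using hv
  have hlt : LinearMap.range f < LinearMap.range f ⊔ Submodule.span k {g x} := by
    refine lt_of_le_of_ne le_sup_left fun h => hgx ?_
    rw [h]
    exact Submodule.mem_sup_right (Submodule.mem_span_singleton_self _)
  refine ⟨μ, (Submodule.finrank_lt_finrank_of_lt hlt).trans_le ?_⟩
  rw [(Submodule.equivMapOfInjective _ hinj _).finrank_eq]
  refine Submodule.finrank_mono ?_
  rw [Submodule.map_le_iff_le_comap, sup_le_iff, Submodule.span_singleton_le_iff_mem]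
  constructor
  · intro w hw
    exact ⟨s ⟨w, hw⟩, by simp [hfs, ← hTf]⟩
  · exact ⟨-μ • x, by simp [hTx, hx]⟩

/-- The linear map `x ↦ ξ ⁅x, ·⁆`. -/
def lieForm (k : Type*) [Field k] (L : Type*) [LieRing L] [LieAlgebra k L]
    (ξ : Module.Dual k L) : L →ₗ[k] Module.Dual k L :=
  (LieModule.toEnd k L L : L →ₗ[k] Module.End k L).compr₂ ξ

@[simp]
theorem lieForm_apply {k L : Type*} [Field k] [LieRing L] [LieAlgebra k L]
    (ξ : Module.Dual k L) (x y : L) : lieForm k L ξ x y = ξ ⁅x, y⁆ := rfl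

theorem ker_lieForm {k L : Type*} [Field k] [LieRing L] [LieAlgebra k L]
    (ξ : Module.Dual k L) : LinearMap.ker (lieForm k L ξ) = lieStab k L ξ := by
  ext x
  exact LinearMap.ext_iff

theorem finrank_range_lieForm_add_finrank_lieStab {k L : Type*} [Field k] [LieRing L]
    [LieAlgebra k L] [Module.Finite k L] (ξ : Module.Dual k L) :
    finrank k (LinearMap.range (lieForm k L ξ)) + finrank k (lieStab k L ξ) = finrank k L := by
  rw [← ker_lieForm, LinearMap.finrank_range_add_finrank_ker]

/-- The stabilizer of a regular functional is commutative. -/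
theorem lie_eq_zero_of_mem_lieStab {k L : Type*} [Field k] [Infinite k] [LieRing L]
    [LieAlgebra k L] [Module.Finite k L] {ξ : Module.Dual k L}
    (hξ : ∀ η : Module.Dual k L, finrank k (lieStab k L ξ) ≤ finrank k (lieStab k L η))
    {x y : L} (hx : x ∈ lieStab k L ξ) (hy : y ∈ lieStab k L ξ) : ⁅x, y⁆ = 0 := by
  rw [← Module.forall_dual_apply_eq_zero_iff k]
  intro η
  have hmem : lieForm k L η x ∈ LinearMap.range (lieForm k L ξ) := by
    by_contra h
    obtain ⟨μ, hμ⟩ := exists_finrank_range_lt_finrank_range_sub_smul (lieForm k L ξ)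
      (lieForm k L η) (by rwa [← ker_lieForm] at hx) h
    have hsub : lieForm k L η - μ • lieForm k L ξ = lieForm k L (η - μ • ξ) := by
      ext; simp
    rw [hsub] at hμ
    have h₁ := finrank_range_lieForm_add_finrank_lieStab ξ
    have h₂ := finrank_range_lieForm_add_finrank_lieStab (η - μ • ξ)
    have h₃ := hξ (η - μ • ξ)
    omega
  obtain ⟨z, hz⟩ := hmem
  rw [← lieForm_apply, ← hz, lieForm_apply, ← lie_skew, map_neg, hy z, neg_zero]

theorem lieIndex_le_maxAbelianDim (k : Type*) [Field k] [CharZero k]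
    (L : Type*) [LieRing L] [LieAlgebra k L] [Module.Finite k L] :
    lieIndex k L ≤ maxAbelianDim k L := by
  obtain ⟨ξ, hξ⟩ := Nat.sInf_mem
    (Set.range_nonempty fun ξ : Module.Dual k L => finrank k (lieStab k L ξ))
  have hcomm {x y : L} (hx : x ∈ lieStab k L ξ) (hy : y ∈ lieStab k L ξ) : ⁅x, y⁆ = 0 :=
    lie_eq_zero_of_mem_lieStab (fun η => hξ.trans_le (Nat.sInf_le ⟨η, rfl⟩)) hx hy
  let H : LieSubalgebra k L :=
    { lieStab k L ξ with
      lie_mem' := fun {x y} hx hy => by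
        rw [hcomm hx hy]
        exact (lieStab k L ξ).zero_mem }
  refine le_csSup ⟨finrank k L, ?_⟩ ⟨H, ⟨fun x y => Subtype.ext (hcomm x.2 y.2)⟩, hξ⟩
  rintro d ⟨H', -, rfl⟩
  exact H'.toSubmodule.finrank_le
end

section
/- Let H be a Lie subalgebra of L of codimension one. If L admits a commutative polarization (an abelian subalgebra P with dim P = c(L)), then H satisfies Rentschler's property: α(H) ≥ c(H) − 1. -/
open Module

/-- Restricting a functional to a codimension-one subalgebra enlarges the stabilizer by at most
one dimension. -/
theorem finrank_lieStab_restrict_le {k : Type*} [Field k] {L : Type*} [LieRing L] [LieAlgebra k L]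
    [Module.Finite k L] (H : LieSubalgebra k L) (hcodim : finrank k H + 1 = finrank k L)
    (ξ : Module.Dual k L) :
    finrank k (lieStab k H (ξ ∘ₗ H.toSubmodule.subtype)) ≤ finrank k (lieStab k L ξ) + 1 := by
  have hH : finrank k H.toSubmodule = finrank k H := rfl
  have hne : H.toSubmodule ≠ ⊤ := by
    intro h
    have h1 : finrank k H.toSubmodule = finrank k L := by rw [h, finrank_top]
    omega
  obtain ⟨y₀, -, hy₀⟩ := SetLike.exists_of_lt (lt_top_iff_ne_top.mpr hne)
  have hlt : H.toSubmodule < H.toSubmodule ⊔ Submodule.span k {y₀} :=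
    lt_of_le_of_ne le_sup_left fun h => hy₀ <| by
      rw [h]
      exact Submodule.mem_sup_right (Submodule.mem_span_singleton_self y₀)
  have htop : H.toSubmodule ⊔ Submodule.span k {y₀} = ⊤ := by
    apply Submodule.eq_top_of_finrank_eq
    have h1 := Submodule.finrank_lt_finrank_of_lt hlt
    have h2 := Submodule.finrank_le (H.toSubmodule ⊔ Submodule.span k {y₀})
    omega
  let V := lieStab k H (ξ ∘ₗ H.toSubmodule.subtype)
  let f : V →ₗ[k] k :=
    { toFun := fun x => ξ ⁅((x : H) : L), y₀⁆
      map_add' := fun a b => by simp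
      map_smul' := fun c a => by simp }
  have hker (x : LinearMap.ker f) : (((x : V) : H) : L) ∈ lieStab k L ξ := by
    intro y
    obtain ⟨h, hh, z, hz, rfl⟩ := Submodule.mem_sup.mp (htop ▸ Submodule.mem_top (x := y))
    obtain ⟨c, rfl⟩ := Submodule.mem_span_singleton.mp hz
    have h1 : ξ ⁅(((x : V) : H) : L), h⁆ = 0 := (x : V).2 ⟨h, hh⟩
    have h2 : ξ ⁅(((x : V) : H) : L), y₀⁆ = 0 := x.2
    rw [lie_add, lie_smul, map_add, map_smul, h1, h2, smul_zero, add_zero]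
  let g : LinearMap.ker f →ₗ[k] lieStab k L ξ :=
    LinearMap.codRestrict _
      (H.toSubmodule.subtype ∘ₗ V.subtype ∘ₗ (LinearMap.ker f).subtype) hker
  have hg : Function.Injective g := fun a b hab =>
    Subtype.ext <| Subtype.ext <| Subtype.ext <|
      congrArg (Subtype.val : lieStab k L ξ → L) hab
  have h1 := LinearMap.finrank_le_finrank_of_injective hg
  have h2 := LinearMap.finrank_range_add_finrank_ker f
  have h3 : finrank k (LinearMap.range f) ≤ 1 :=
    (Submodule.finrank_le _).trans_eq (finrank_self k)
  change finrank k V ≤ _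
  omega

theorem lieIndex_le_of_codim_one {k : Type*} [Field k] {L : Type*} [LieRing L] [LieAlgebra k L]
    [Module.Finite k L] (H : LieSubalgebra k L) (hcodim : finrank k H + 1 = finrank k L) :
    lieIndex k H ≤ lieIndex k L + 1 := by
  obtain ⟨ξ, hξ⟩ := Nat.sInf_mem
    (Set.range_nonempty fun ξ : Module.Dual k L => finrank k (lieStab k L ξ))
  calc lieIndex k H ≤ finrank k (lieStab k H (ξ ∘ₗ H.toSubmodule.subtype)) :=
        Nat.sInf_le ⟨_, rfl⟩
    _ ≤ finrank k (lieStab k L ξ) + 1 := finrank_lieStab_restrict_le H hcodim ξ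
    _ = lieIndex k L + 1 := congrArg (· + 1) hξ

theorem magic_le_of_codim_one {k : Type*} [Field k] {L : Type*} [LieRing L] [LieAlgebra k L]
    [Module.Finite k L] (H : LieSubalgebra k L) (hcodim : finrank k H + 1 = finrank k L) :
    magic k H ≤ magic k L := by
  have := lieIndex_le_of_codim_one H hcodim
  exact Nat.div_le_div_right (by omega)

theorem finrank_le_maxAbelianDim {k : Type*} [Field k] {L : Type*} [LieRing L] [LieAlgebra k L]
    [Module.Finite k L] (A : LieSubalgebra k L) (hA : IsLieAbelian A) :
    finrank k A ≤ maxAbelianDim k L := by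
  refine le_csSup ⟨finrank k L, ?_⟩ ⟨A, hA, rfl⟩
  rintro _ ⟨B, -, rfl⟩
  exact Submodule.finrank_le B.toSubmodule

/-- An abelian subalgebra loses at most one dimension when intersected with a codimension-one
subalgebra. -/
theorem finrank_le_maxAbelianDim_add_one {k : Type*} [Field k] {L : Type*} [LieRing L]
    [LieAlgebra k L] [Module.Finite k L] (H P : LieSubalgebra k L)
    (hcodim : finrank k H + 1 = finrank k L) (hP : IsLieAbelian P) :
    finrank k P ≤ maxAbelianDim k H + 1 := by
  have hab : IsLieAbelian (P.comap H.incl) := by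
    refine ⟨fun x y => Subtype.ext <| Subtype.ext ?_⟩
    exact congrArg (Subtype.val : P → L) (hP.trivial ⟨_, x.2⟩ ⟨_, y.2⟩)
  have h1 := finrank_le_maxAbelianDim (P.comap H.incl) hab
  have h2 : finrank k (P.comap H.incl) =
      finrank k (H.toSubmodule ⊓ P.toSubmodule : Submodule k L) := by
    rw [← Submodule.map_comap_subtype]
    exact (Submodule.finrank_map_subtype_eq H.toSubmodule
      (P.toSubmodule.comap H.toSubmodule.subtype)).symm
  have h3 := Submodule.finrank_sup_add_finrank_inf_eq H.toSubmodule P.toSubmodule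
  have h4 := Submodule.finrank_le (H.toSubmodule ⊔ P.toSubmodule)
  have h5 : finrank k H.toSubmodule = finrank k H := rfl
  have h6 : finrank k P.toSubmodule = finrank k P := rfl
  omega

/-- if L admits a CP, then any codimension-one subalgebra H satisfies
Rentschler's property. -/
theorem rentschler_of_codim_one_CP (k : Type*) [Field k] [CharZero k]
    (L : Type*) [LieRing L] [LieAlgebra k L] [Module.Finite k L]
    (H : LieSubalgebra k L) (hcodim : finrank k H + 1 = finrank k L)
    (hCP : ∃ P : LieSubalgebra k L, IsLieAbelian P ∧ finrank k P = magic k L) :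
    magic k H - 1 ≤ maxAbelianDim k H := by
  obtain ⟨P, hP, hdim⟩ := hCP
  have h1 := magic_le_of_codim_one H hcodim
  have h2 := finrank_le_maxAbelianDim_add_one H P hcodim hP
  omega
end
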